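/- Let 0 < γ < mn, take γ_i = γ/m for every i, let p⃗ be a vector of exponents, and let δ < τ, where τ = (γ-mn)(1-1/m) + 1/m. If a pair of weights (w,v⃗) satisfies the local condition, then (w,v⃗) satisfies the global condition. -/

import Mathlib

open MeasureTheory Metric Set
open scoped ENNReal NNReal BigOperators Classical

noncomputable section

/-- Euclidean `n`-space. -/
abbrev Rn (n : ℕ) := EuclideanSpace ℝ (Fin n)

/-- The conjugate exponent in `ℝ≥0∞`. -/
def conjE (q : ℝ≥0∞) : ℝ≥0∞ :=
  if q = 1 then ∞ else if q = ∞ then 1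
  else ENNReal.ofReal (q.toReal / (q.toReal - 1))

/-- An `L^q`-type quantity on the set `s` for an `ℝ≥0∞`-valued function `g`:
the usual integral expression for `q < ∞`, and the essential supremum for `q = ∞`. -/
def lpOn {n : ℕ} (q : ℝ≥0∞) (g : Rn n → ℝ≥0∞) (s : Set (Rn n)) : ℝ≥0∞ :=
  if q = ∞ then essSup g (volume.restrict s)
  else (∫⁻ y in s, g y ^ q.toReal) ^ (1 / q.toReal)

/-- A weight: measurable, positive and finite a.e., and locally integrable. -/
def IsWeight {n : ℕ} (u : Rn n → ℝ≥0∞) : Prop :=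
  Measurable u ∧ (∀ᵐ x ∂(volume : Measure (Rn n)), 0 < u x ∧ u x < ∞) ∧
    ∀ (x : Rn n) (R : ℝ), 0 < R → ∫⁻ y in ball x R, u y < ∞

/-- The `i`-th factor in the `ℍ_m(p⃗,γ,δ)` condition, where `q = p_i'` is the
conjugate exponent of `p_i` (an essential supremum when `p_i = 1`). -/
def HmFactor {n : ℕ} (m : ℕ) (γi : ℝ) (q : ℝ≥0∞) (vi : Rn n → ℝ≥0∞)
    (xB : Rn n) (R : ℝ) : ℝ≥0∞ :=
  lpOn q
    (fun y => (vi y)⁻¹ *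
      (volume (ball xB R) ^ ((n : ℝ)⁻¹) + edist xB y) ^
        (-((n : ℝ) - γi + 1 / (m : ℝ))))
    Set.univ

/-- The class `ℍ_m(p⃗,γ,δ)` for a pair `(w, v⃗)`. -/
def Hm {n : ℕ} (m : ℕ) (γv : Fin m → ℝ) (δ : ℝ) (p : Fin m → ℝ≥0∞)
    (w : Rn n → ℝ≥0∞) (v : Fin m → Rn n → ℝ≥0∞) : Prop :=
  ∃ C : ℝ, 0 < C ∧ ∀ (xB : Rn n) (R : ℝ), 0 < R →
    essSup w (volume.restrict (ball xB R)) *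
        volume (ball xB R) ^ (-((δ - 1) / (n : ℝ))) *
        ∏ i, HmFactor m (γv i) (conjE (p i)) (v i) xB R
      ≤ ENNReal.ofReal C

/-- The global condition associated to `ℍ_m(p⃗,γ,δ)`. -/
def GlobalCond {n : ℕ} (m : ℕ) (γv : Fin m → ℝ) (δ : ℝ) (p : Fin m → ℝ≥0∞)
    (w : Rn n → ℝ≥0∞) (v : Fin m → Rn n → ℝ≥0∞) : Prop :=
  ∃ C : ℝ, 0 < C ∧ ∀ (xB : Rn n) (R : ℝ), 0 < R →
    essSup w (volume.restrict (ball xB R)) *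
        volume (ball xB R) ^ (-((δ - 1) / (n : ℝ))) *
        ∏ i, lpOn (conjE (p i))
          (fun y => (v i y)⁻¹ * edist xB y ^ (-((n : ℝ) - γv i + 1 / (m : ℝ))))
          (ball xB R)ᶜ
      ≤ ENNReal.ofReal C

/-- The local condition associated to `ℍ_m(p⃗,γ,δ)`. -/
def LocalCond {n : ℕ} (m : ℕ) (γ δ : ℝ) (p : Fin m → ℝ≥0∞)
    (w : Rn n → ℝ≥0∞) (v : Fin m → Rn n → ℝ≥0∞) : Prop :=
  ∃ C : ℝ, 0 < C ∧ ∀ (xB : Rn n) (R : ℝ), 0 < R →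
    essSup w (volume.restrict (ball xB R)) *
        volume (ball xB R) ^
          (-(δ / (n : ℝ)) + γ / (n : ℝ) - ∑ i, ((p i)⁻¹).toReal) *
        ∏ i, (volume (ball xB R) ^ (-(((conjE (p i))⁻¹).toReal)) *
          lpOn (conjE (p i)) (fun y => (v i y)⁻¹) (ball xB R))
      ≤ ENNReal.ofReal C

/-- The reverse Hölder class `RH_s`. -/
def memRH {n : ℕ} (s : ℝ) (u : Rn n → ℝ≥0∞) : Prop :=
  ∃ C : ℝ, 0 < C ∧ ∀ (x : Rn n) (R : ℝ), 0 < R →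
    ((volume (ball x R))⁻¹ * ∫⁻ y in ball x R, u y ^ s) ^ (1 / s) ≤
      ENNReal.ofReal C * ((volume (ball x R))⁻¹ * ∫⁻ y in ball x R, u y)

/-- The reverse Hölder class `RH_∞`. -/
def memRHinf {n : ℕ} (u : Rn n → ℝ≥0∞) : Prop :=
  ∃ C : ℝ, 0 < C ∧ ∀ (x : Rn n) (R : ℝ), 0 < R →
    essSup u (volume.restrict (ball x R)) ≤
      ENNReal.ofReal C * ((volume (ball x R))⁻¹ * ∫⁻ y in ball x R, u y)

/-- Doubling condition for an `ℝ≥0∞`-valued weight. -/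
def IsDoubling {n : ℕ} (u : Rn n → ℝ≥0∞) : Prop :=
  ∃ C : ℝ, 0 < C ∧ ∀ (x : Rn n) (R : ℝ), 0 < R →
    ∫⁻ y in ball x (2 * R), u y ≤ ENNReal.ofReal C * ∫⁻ y in ball x R, u y

/-- The multilinear class `A_{p⃗,∞}`. -/
def ApInfty {n : ℕ} (m : ℕ) (p : Fin m → ℝ≥0∞) (v : Fin m → Rn n → ℝ≥0∞) : Prop :=
  ∃ C : ℝ, 0 < C ∧ ∀ (xB : Rn n) (R : ℝ), 0 < R →
    essSup (fun x => ∏ i, v i x) (volume.restrict (ball xB R)) *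
        ∏ i, (volume (ball xB R) ^ (-(((conjE (p i))⁻¹).toReal)) *
          lpOn (conjE (p i)) (fun y => (v i y)⁻¹) (ball xB R))
      ≤ ENNReal.ofReal C

/-- The kernel of the modified multilinear fractional operator `J_{γ,m}`. -/
def Jker {n : ℕ} (m : ℕ) (γ : ℝ) (x : Rn n) (y : Fin m → Rn n) : ℝ :=
  (∑ i, dist x (y i)) ^ (γ - (m : ℝ) * (n : ℝ)) -
    (if ∀ i, y i ∈ ball (0 : Rn n) 1 then 0
     else (∑ i, dist (0 : Rn n) (y i)) ^ (γ - (m : ℝ) * (n : ℝ)))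

/-- The modified multilinear fractional operator `J_{γ,m}`. -/
def Jop {n m : ℕ} (γ : ℝ) (f : Fin m → Rn n → ℝ) (x : Rn n) : ℝ :=
  ∫ y : Fin m → Rn n, Jker m γ x y * ∏ i, f i (y i)

/-- The vector `(1,…,1)` in `ℝⁿ`. -/
def uvec (n : ℕ) : Rn n := (EuclideanSpace.equiv (Fin n) ℝ).symm fun _ => 1

/-- The quadrant `A` associated to a ball with center `xB`. -/
def Aset {n : ℕ} (xB : Rn n) : Set (Rn n) := {y | ∀ i, xB i ≤ y i}

/-- The set `C₁` associated to a ball `B(xB,R)`. -/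
def C1set {n : ℕ} (xB : Rn n) (R : ℝ) : Set (Rn n) :=
  ball (xB - (R / (12 * Real.sqrt n)) • uvec n) (R / (12 * Real.sqrt n)) ∩
    {y | ∀ i, y i ≤ (xB - (R / (12 * Real.sqrt n)) • uvec n) i}

/-- The set `C₂` associated to a ball `B(xB,R)`. -/
def C2set {n : ℕ} (xB : Rn n) (R : ℝ) : Set (Rn n) :=
  ball (xB - (R / (3 * Real.sqrt n)) • uvec n) (2 * R / 3) ∩
    {y | ∀ i, y i ≤ (xB - (R / (3 * Real.sqrt n)) • uvec n) i}

theorem aux_conj (q : ℝ≥0∞) (hq : 1 ≤ q) :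
    conjE q ≠ 0 ∧ ((conjE q)⁻¹).toReal + (q⁻¹).toReal = 1 := by
  unfold conjE
  split_ifs with h1 h2
  · simp [h1]
  · simp [h2]
  · have h3 : 1 < q := lt_of_le_of_ne hq (Ne.symm h1)
    have h4 : 1 < q.toReal := by
      have := (ENNReal.toReal_lt_toReal ENNReal.one_ne_top h2).2 h3
      simpa using this
    have h5 : 0 < q.toReal / (q.toReal - 1) := div_pos (by linarith) (by linarith)
    refine ⟨by simpa using h5, ?_⟩
    rw [ENNReal.toReal_inv, ENNReal.toReal_inv, ENNReal.toReal_ofReal h5.le]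
    have : q.toReal - 1 ≠ 0 := by linarith
    field_simp
    ring

theorem aux_mono {n : ℕ} (q : ℝ≥0∞) (g : Rn n → ℝ≥0∞) {s t : Set (Rn n)} (h : s ⊆ t) :
    lpOn q g s ≤ lpOn q g t := by
  unfold lpOn
  split_ifs
  · exact essSup_mono_measure (Measure.restrict_mono h le_rfl).absolutelyContinuous
  · exact ENNReal.rpow_le_rpow (lintegral_mono_set h) (by positivity)

theorem aux_prod {ι : Type*} (f : ι → ℕ → ℝ≥0∞) (D : ℝ≥0∞) (s : Finset ι) :
    ∀ A : ℝ≥0∞, (∀ k : ι → ℕ, A * ∏ i ∈ s, f i (k i) ≤ D) →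
      A * ∏ i ∈ s, ⨆ j, f i j ≤ D := by
  induction s using Finset.induction_on with
  | empty => intro A h; simpa using h (fun _ => 0)
  | insert a s ha ih =>
    intro A h
    rw [Finset.prod_insert ha, ← mul_assoc, ENNReal.mul_iSup, ENNReal.iSup_mul]
    refine iSup_le fun j => ih _ fun k => ?_
    have := h (Function.update k a j)
    rw [Finset.prod_insert ha, ← mul_assoc] at this
    convert this using 2
    · simp
    · refine Finset.prod_congr rfl fun i hi => ?_
      have : i ≠ a := fun e => ha (e ▸ hi)
      simp [this]

theorem aux_shell {n : ℕ} (x : Rn n) (R : ℝ) (hR : 0 < R) (a : ℝ) (ha : 0 < a) (y : Rn n)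
    (hy : y ∈ (ball x R)ᶜ) :
    ∃ k : ℕ, y ∈ ball x (2 ^ (k + 1) * R) ∧
      edist x y ^ (-a) ≤ ENNReal.ofReal (((2 : ℝ) ^ k * R) ^ (-a)) := by
  have hy' : R ≤ dist x y := by
    simpa [dist_comm] using hy
  obtain ⟨k, hk1, hk2⟩ := exists_nat_pow_near (x := dist x y / R) (y := (2 : ℝ))
    (by rw [le_div_iff₀ hR]; linarith) (by norm_num)
  rw [le_div_iff₀ hR] at hk1
  rw [div_lt_iff₀ hR] at hk2
  refine ⟨k, by rw [mem_ball, dist_comm]; exact hk2, ?_⟩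
  have hpos : 0 < (2 : ℝ) ^ k * R := by positivity
  rw [← ENNReal.ofReal_rpow_of_pos hpos, edist_dist, ENNReal.rpow_neg, ENNReal.rpow_neg]
  exact ENNReal.inv_le_inv.2 (ENNReal.rpow_le_rpow (ENNReal.ofReal_le_ofReal hk1) ha.le)

theorem aux_lp {n : ℕ} (q : ℝ≥0∞) (hq : q ≠ 0) (a ε : ℝ) (ha : 0 < a) (hε : 0 < ε) :
    ∃ S : ℝ≥0∞, S ≠ ∞ ∧ ∀ (u : Rn n → ℝ≥0∞) (x : Rn n) (R : ℝ), 0 < R →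
      lpOn q (fun y => u y * edist x y ^ (-a)) (ball x R)ᶜ ≤
        S * ⨆ k : ℕ, ENNReal.ofReal (((2 : ℝ) ^ k) ^ ε * ((2 : ℝ) ^ k * R) ^ (-a)) *
          lpOn q u (ball x (2 ^ (k + 1) * R)) := by
  by_cases hqt : q = ∞
  · refine ⟨1, by simp, fun u x R hR => ?_⟩
    subst hqt
    rw [one_mul]
    simp only [lpOn, if_true]
    refine essSup_le_of_ae_le _ ?_
    have h1 : ∀ᵐ y ∂(volume : Measure (Rn n)), ∀ k : ℕ, y ∈ ball x (2 ^ (k + 1) * R) →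
        u y ≤ essSup u (volume.restrict (ball x (2 ^ (k + 1) * R))) := by
      rw [ae_all_iff]
      intro k
      exact (ae_restrict_iff' measurableSet_ball).1 (ENNReal.ae_le_essSup u)
    refine (ae_restrict_iff' measurableSet_ball.compl).2 ?_
    filter_upwards [h1] with y hy hyR
    obtain ⟨k, hk1, hk2⟩ := aux_shell x R hR a ha y hyR
    refine le_trans ?_ (le_iSup _ k)
    rw [mul_comm]
    refine mul_le_mul' (hk2.trans (ENNReal.ofReal_le_ofReal ?_)) (hy k hk1)
    refine le_mul_of_one_le_left (by positivity) ?_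
    exact Real.one_le_rpow (one_le_pow₀ (by norm_num)) hε.le
  · have hr : 0 < q.toReal := ENNReal.toReal_pos hq hqt
    set r := q.toReal with hrdef
    set T : ℝ≥0∞ := ∑' k : ℕ, ENNReal.ofReal ((((2 : ℝ) ^ k) ^ (-ε)) ^ r) with hT
    have hTt : T ≠ ∞ := by
      have hs : Summable fun k : ℕ => (((2 : ℝ) ^ k) ^ (-ε)) ^ r := by
        have : (fun k : ℕ => (((2 : ℝ) ^ k) ^ (-ε)) ^ r) = fun k : ℕ => ((2 : ℝ) ^ (-ε * r)) ^ k := by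
          funext k
          rw [← Real.rpow_natCast, ← Real.rpow_natCast, ← Real.rpow_mul (by norm_num),
            ← Real.rpow_mul (by norm_num), ← Real.rpow_mul (by norm_num)]
          congr 1; ring
        rw [this]
        refine summable_geometric_of_lt_one (by positivity) ?_
        exact Real.rpow_lt_one_of_one_lt_of_neg (by norm_num) (by nlinarith)
      exact hs.tsum_ofReal_ne_top
    refine ⟨T ^ (1 / r), ENNReal.rpow_ne_top_of_nonneg (by positivity) hTt, fun u x R hR => ?_⟩
    simp only [lpOn, if_neg hqt, ← hrdef]
    set M := ⨆ k : ℕ, ENNReal.ofReal (((2 : ℝ) ^ k) ^ ε * ((2 : ℝ) ^ k * R) ^ (-a)) *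
          (∫⁻ y in ball x (2 ^ (k + 1) * R), u y ^ r) ^ (1 / r) with hM
    suffices h : ∫⁻ y in (ball x R)ᶜ, (u y * edist x y ^ (-a)) ^ r ≤ T * M ^ r by
      refine (ENNReal.rpow_le_rpow h (by positivity : 0 ≤ 1 / r)).trans ?_
      rw [ENNReal.mul_rpow_of_nonneg _ _ (by positivity), ← ENNReal.rpow_mul,
        mul_one_div_cancel hr.ne', ENNReal.rpow_one]
    let A : ℕ → Set (Rn n) := fun k => {y | y ∈ ball x (2 ^ (k + 1) * R) ∧
      edist x y ^ (-a) ≤ ENNReal.ofReal (((2 : ℝ) ^ k * R) ^ (-a))}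
    have hsub : (ball x R)ᶜ ⊆ ⋃ k, A k := fun y hy => by
      obtain ⟨k, hk⟩ := aux_shell x R hR a ha y hy
      exact mem_iUnion.2 ⟨k, hk⟩
    have hAm : ∀ k, MeasurableSet (A k) := fun k => by
      have h2 : MeasurableSet {y : Rn n | edist x y ^ (-a) ≤
          ENNReal.ofReal (((2 : ℝ) ^ k * R) ^ (-a))} :=
        measurableSet_le ((measurable_edist_right).pow_const _) measurable_const
      exact MeasurableSet.inter (measurableSet_ball (x := x) (ε := 2 ^ (k + 1) * R)) h2
    refine (lintegral_mono_set hsub).trans ((lintegral_iUnion_le _ _).trans ?_)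
    rw [hT, ← ENNReal.tsum_mul_right]
    refine ENNReal.tsum_le_tsum fun k => ?_
    set c := ENNReal.ofReal (((2 : ℝ) ^ k * R) ^ (-a)) with hc
    set J := ∫⁻ y in ball x (2 ^ (k + 1) * R), u y ^ r with hJ
    have e1 : ∫⁻ y in A k, (u y * edist x y ^ (-a)) ^ r ≤ c ^ r * J := by
      calc ∫⁻ y in A k, (u y * edist x y ^ (-a)) ^ r
          ≤ ∫⁻ y in A k, c ^ r * u y ^ r := by
            refine setLIntegral_mono' (hAm k) fun y hy => ?_
            rw [← ENNReal.mul_rpow_of_nonneg _ _ hr.le, mul_comm]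
            exact ENNReal.rpow_le_rpow (mul_le_mul' hy.2 le_rfl) hr.le
        _ ≤ ∫⁻ y in ball x (2 ^ (k + 1) * R), c ^ r * u y ^ r :=
            lintegral_mono_set fun y hy => hy.1
        _ = c ^ r * J := lintegral_const_mul' _ _
            (ENNReal.rpow_ne_top_of_nonneg hr.le ENNReal.ofReal_ne_top)
    have e2 : ENNReal.ofReal (((2 : ℝ) ^ k) ^ ε * ((2 : ℝ) ^ k * R) ^ (-a)) * J ^ (1 / r) ≤ M :=
      le_iSup (fun k : ℕ => ENNReal.ofReal (((2 : ℝ) ^ k) ^ ε * ((2 : ℝ) ^ k * R) ^ (-a)) *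
          (∫⁻ y in ball x (2 ^ (k + 1) * R), u y ^ r) ^ (1 / r)) k
    have e3 : c * J ^ (1 / r) ≤ ENNReal.ofReal (((2 : ℝ) ^ k) ^ (-ε)) * M := by
      refine le_trans (le_of_eq ?_) (mul_le_mul' le_rfl e2)
      rw [← mul_assoc, ← ENNReal.ofReal_mul (by positivity), ← mul_assoc,
        ← Real.rpow_add (by positivity)]
      simp [hc]
    refine e1.trans ?_
    have e4 := ENNReal.rpow_le_rpow e3 hr.le
    rw [ENNReal.mul_rpow_of_nonneg _ _ hr.le, ENNReal.mul_rpow_of_nonneg _ _ hr.le,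
      ← ENNReal.rpow_mul, one_div_mul_cancel hr.ne', ENNReal.rpow_one] at e4
    rw [← ENNReal.ofReal_rpow_of_nonneg (by positivity) hr.le]
    exact e4

theorem aux_vol (n : ℕ) :
    ∃ ω : ℝ, 0 < ω ∧ ∀ (x : Rn n) (R : ℝ), 0 < R →
      volume (ball x R) = ENNReal.ofReal (ω * R ^ n) := by
  have hfin : volume (ball (0 : Rn n) 1) ≠ ∞ := measure_ball_lt_top.ne
  refine ⟨(volume (ball (0 : Rn n) 1)).toReal,
    ENNReal.toReal_pos (measure_ball_pos _ _ one_pos).ne' hfin, fun x R hR => ?_⟩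
  rw [Measure.addHaar_ball_of_pos _ _ hR, ENNReal.ofReal_mul ENNReal.toReal_nonneg,
    ENNReal.ofReal_toReal hfin, mul_comm]
  simp

theorem aux_real {m n : ℕ} (hn : 1 ≤ n) (γ δ a b ε ω R : ℝ) (hω : 0 < ω) (hR : 0 < R)
    (hb : b = δ - γ + m * n) (hma : m * a = m * n - γ + 1) (hε : ε = a - max b 0)
    (k : Fin m → ℕ) :
    (ω * R ^ n) ^ (-((δ - 1) / (n : ℝ))) *
      (∏ i, ((2 : ℝ) ^ (k i)) ^ ε * ((2 : ℝ) ^ (k i) * R) ^ (-a)) *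
      (ω * (2 ^ ((∑ i, k i) + 1) * R) ^ n) ^ (b / n) ≤
    ω ^ (-((δ - 1) / (n : ℝ))) * ω ^ (b / n) * 2 ^ b := by
  have hn' : (n : ℝ) ≠ 0 := by positivity
  have h1 : (ω * R ^ n) ^ (-((δ - 1) / (n : ℝ))) = ω ^ (-((δ - 1) / (n : ℝ))) * R ^ (1 - δ) := by
    rw [Real.mul_rpow hω.le (by positivity), ← Real.rpow_natCast, ← Real.rpow_mul hR.le]
    congr 2; field_simp; ring
  have h2 : (ω * (2 ^ ((∑ i, k i) + 1) * R) ^ n) ^ (b / n) =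
      ω ^ (b / n) * ((2 : ℝ) ^ b * (2 ^ (∑ i, k i)) ^ b * R ^ b) := by
    rw [Real.mul_rpow hω.le (by positivity), ← Real.rpow_natCast _ n,
      ← Real.rpow_mul (by positivity), mul_div_cancel₀ _ hn',
      Real.mul_rpow (by positivity) hR.le, pow_succ', Real.mul_rpow (by positivity) (by positivity)]
  have h3 : (∏ i, ((2 : ℝ) ^ (k i)) ^ ε * ((2 : ℝ) ^ (k i) * R) ^ (-a)) =
      ((2 : ℝ) ^ (∑ i, k i)) ^ (-max b 0) * R ^ (-(m * a)) := by
    have : ∀ i, ((2 : ℝ) ^ (k i)) ^ ε * ((2 : ℝ) ^ (k i) * R) ^ (-a) =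
        ((2 : ℝ) ^ (k i)) ^ (-max b 0) * R ^ (-a) := fun i => by
      rw [Real.mul_rpow (by positivity) hR.le, ← mul_assoc, ← Real.rpow_add (by positivity), hε]
      congr 2; ring
    simp only [this]
    rw [Finset.prod_mul_distrib, Real.finsetProd_rpow _ _ (fun i _ => by positivity),
      Finset.prod_pow_eq_pow_sum, Finset.prod_const, Finset.card_univ, Fintype.card_fin,
      ← Real.rpow_natCast (R ^ (-a)), ← Real.rpow_mul hR.le]
    congr 2; ring
  rw [h1, h2, h3]
  have h4 : R ^ (1 - δ) * R ^ (-(m * a)) * R ^ b = 1 := by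
    rw [← Real.rpow_add hR, ← Real.rpow_add hR, hma, hb]
    ring_nf; simp
  have h5 : ((2 : ℝ) ^ (∑ i, k i)) ^ (-max b 0) * ((2 : ℝ) ^ (∑ i, k i)) ^ b ≤ 1 := by
    rw [← Real.rpow_add (by positivity)]
    refine Real.rpow_le_one_of_one_le_of_nonpos (one_le_pow₀ (by norm_num)) ?_
    have := le_max_left b 0
    linarith
  calc _ = (ω ^ (-((δ - 1) / (n : ℝ))) * ω ^ (b / n) * 2 ^ b) *
        (R ^ (1 - δ) * R ^ (-(m * a)) * R ^ b) *
        (((2 : ℝ) ^ (∑ i, k i)) ^ (-max b 0) * ((2 : ℝ) ^ (∑ i, k i)) ^ b) := by ring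
    _ ≤ _ := by
      rw [h4, mul_one]
      exact mul_le_of_le_one_right (by positivity) h5

/-- with `γ_i = γ/m` and `δ < τ = (γ-mn)(1-1/m)+1/m`, the local
condition implies the global condition. -/
theorem statement8 {n m : ℕ} (hn : 1 ≤ n) (hm : 1 ≤ m) (γ δ : ℝ) (hγ0 : 0 < γ)
    (hγ : γ < m * n)
    (hδ : δ < (γ - m * n) * (1 - 1 / (m : ℝ)) + 1 / (m : ℝ))
    (p : Fin m → ℝ≥0∞) (hp : ∀ i, 1 ≤ p i)
    (w : Rn n → ℝ≥0∞) (v : Fin m → Rn n → ℝ≥0∞) (hw : IsWeight w)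
    (hv : ∀ i, IsWeight (v i))
    (hloc : LocalCond m γ δ p w v) :
    GlobalCond m (fun _ => γ / m) δ p w v := by
  obtain ⟨C, hC, hloc⟩ := hloc
  have hn' : (0 : ℝ) < n := by exact_mod_cast hn
  have hm' : (0 : ℝ) < m := by exact_mod_cast hm
  obtain ⟨ω, hω, hvol⟩ := aux_vol n
  set a : ℝ := (n : ℝ) - γ / m + 1 / (m : ℝ) with ha
  obtain ⟨b, hb⟩ : ∃ b : ℝ, b = δ - γ + m * n := ⟨_, rfl⟩
  have hma : m * a = m * n - γ + 1 := by rw [ha]; field_simp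
  have ha0 : 0 < a := by
    have : 0 < m * a := by rw [hma]; linarith
    exact (pos_iff_pos_of_mul_pos this).1 hm'
  have hba : b < a := by
    have e : (γ - m * n) * (1 - 1 / (m : ℝ)) + 1 / (m : ℝ) = γ - m * n + a := by
      rw [ha]; field_simp; ring
    rw [e] at hδ
    linarith
  obtain ⟨ε, hε⟩ : ∃ ε : ℝ, ε = a - max b 0 := ⟨_, rfl⟩
  have hε0 : 0 < ε := by
    rw [hε, sub_pos]; exact max_lt hba ha0
  have hS := fun i => aux_lp (n := n) (conjE (p i)) (aux_conj (p i) (hp i)).1 a ε ha0 hε0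
  choose S hSt hS using hS
  set D : ℝ := ω ^ (-((δ - 1) / (n : ℝ))) * ω ^ (b / n) * 2 ^ b with hD
  have hD0 : 0 < D := by positivity
  have hSP : (∏ i, S i) ≠ ∞ := ENNReal.prod_ne_top fun i _ => hSt i
  have hloc' : ∀ (x : Rn n) (R : ℝ), 0 < R →
      essSup w (volume.restrict (ball x R)) *
        ∏ i, lpOn (conjE (p i)) (fun y => (v i y)⁻¹) (ball x R) ≤
      ENNReal.ofReal C * ENNReal.ofReal ((ω * R ^ n) ^ (b / n)) := by
    intro x R hR
    have h := hloc x R hR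
    have hpos : 0 < ω * R ^ n := by positivity
    have hV0 : ENNReal.ofReal (ω * R ^ n) ≠ 0 := by simpa using hpos
    rw [hvol x R hR] at h
    rw [Finset.prod_mul_distrib] at h
    have hprod : ∏ i, ENNReal.ofReal (ω * R ^ n) ^ (-(((conjE (p i))⁻¹).toReal)) =
        ENNReal.ofReal (ω * R ^ n) ^ (-∑ i, ((conjE (p i))⁻¹).toReal) := by
      rw [← Finset.sum_neg_distrib, ENNReal.ofReal_rpow_of_pos hpos,
        Real.rpow_sum_of_pos hpos, ENNReal.ofReal_prod_of_nonneg fun i _ => by positivity]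
      exact Finset.prod_congr rfl fun i _ => ENNReal.ofReal_rpow_of_pos hpos
    rw [hprod] at h
    have hsum : (∑ i, ((conjE (p i))⁻¹).toReal) + ∑ i, ((p i)⁻¹).toReal = m := by
      rw [← Finset.sum_add_distrib, Finset.sum_congr rfl fun i _ => (aux_conj (p i) (hp i)).2]
      simp
    have hexp : (-(δ / (n : ℝ)) + γ / (n : ℝ) - ∑ i, ((p i)⁻¹).toReal) +
        (-∑ i, ((conjE (p i))⁻¹).toReal) = -(b / n) := by
      have : (-(δ / (n : ℝ)) + γ / (n : ℝ) - ∑ i, ((p i)⁻¹).toReal) +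
        (-∑ i, ((conjE (p i))⁻¹).toReal) = -(δ / (n : ℝ)) + γ / (n : ℝ) - m := by
        rw [← hsum]; ring
      rw [this, hb]; field_simp; ring
    rw [← ENNReal.ofReal_rpow_of_pos hpos]
    set V := ENNReal.ofReal (ω * R ^ n) with hV
    set W := essSup w (volume.restrict (ball x R))
    set N := ∏ i, lpOn (conjE (p i)) (fun y => (v i y)⁻¹) (ball x R)
    have hVt : V ≠ ∞ := ENNReal.ofReal_ne_top
    have h' : W * N * V ^ (-(b / n)) ≤ ENNReal.ofReal C := by
      refine le_trans (le_of_eq ?_) h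
      rw [← hexp, ENNReal.rpow_add _ _ hV0 hVt]
      ring
    calc W * N = W * N * V ^ (-(b / n)) * V ^ (b / n) := by
          rw [mul_assoc (W * N), ← ENNReal.rpow_add _ _ hV0 hVt]; simp
      _ ≤ _ := mul_le_mul' h' le_rfl
  have hfin : (∏ i, S i) * (ENNReal.ofReal C * ENNReal.ofReal D) ≠ ∞ :=
    ENNReal.mul_ne_top hSP (ENNReal.mul_ne_top ENNReal.ofReal_ne_top ENNReal.ofReal_ne_top)
  refine ⟨((∏ i, S i) * (ENNReal.ofReal C * ENNReal.ofReal D)).toReal + 1, by positivity,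
    fun x R hR => ?_⟩
  refine le_trans ?_ (ENNReal.ofReal_le_ofReal (le_add_of_nonneg_right zero_le_one))
  rw [ENNReal.ofReal_toReal hfin]
  refine (mul_le_mul' le_rfl (Finset.prod_le_prod' fun i _ =>
    hS i (fun y => (v i y)⁻¹) x R hR)).trans ?_
  rw [Finset.prod_mul_distrib, mul_left_comm]
  refine mul_le_mul' le_rfl (aux_prod _ _ _ _ fun k => ?_)
  set K := ∑ i, k i with hK
  have hRK : R ≤ 2 ^ (K + 1) * R :=
    le_mul_of_one_le_left hR.le (one_le_pow₀ (by norm_num))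
  have hloc2 := hloc' x (2 ^ (K + 1) * R) (by positivity)
  have hpos : 0 < ω * R ^ n := by positivity
  rw [hvol x R hR, Finset.prod_mul_distrib, ENNReal.ofReal_rpow_of_pos hpos,
    ← ENNReal.ofReal_prod_of_nonneg fun i _ => by positivity]
  have hW : essSup w (volume.restrict (ball x R)) ≤
      essSup w (volume.restrict (ball x (2 ^ (K + 1) * R))) :=
    essSup_mono_measure (Measure.restrict_mono (ball_subset_ball hRK) le_rfl).absolutelyContinuous
  have hN : ∏ i, lpOn (conjE (p i)) (fun y => (v i y)⁻¹) (ball x (2 ^ (k i + 1) * R)) ≤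
      ∏ i, lpOn (conjE (p i)) (fun y => (v i y)⁻¹) (ball x (2 ^ (K + 1) * R)) := by
    refine Finset.prod_le_prod' fun i _ => aux_mono _ _ (ball_subset_ball ?_)
    have : k i ≤ K := Finset.single_le_sum (f := k) (fun _ _ => Nat.zero_le _) (Finset.mem_univ i)
    gcongr
    norm_num
  have hreal := aux_real hn γ δ a b ε ω R hω hR hb hma hε k
  rw [← hK, ← hD] at hreal
  set X := (ω * R ^ n) ^ (-((δ - 1) / (n : ℝ))) with hX
  set Y := (∏ i, ((2 : ℝ) ^ (k i)) ^ ε * ((2 : ℝ) ^ (k i) * R) ^ (-a)) with hY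
  set Z := (ω * (2 ^ (K + 1) * R) ^ n) ^ (b / n) with hZ
  have hX0 : 0 ≤ X := by positivity
  have hY0 : 0 ≤ Y := Finset.prod_nonneg fun i _ => by positivity
  calc _ = ENNReal.ofReal X * ENNReal.ofReal Y * (essSup w (volume.restrict (ball x R)) *
        ∏ i, lpOn (conjE (p i)) (fun y => (v i y)⁻¹) (ball x (2 ^ (k i + 1) * R))) := by ring
    _ ≤ ENNReal.ofReal X * ENNReal.ofReal Y * (ENNReal.ofReal C * ENNReal.ofReal Z) :=
        mul_le_mul' le_rfl ((mul_le_mul' hW hN).trans hloc2)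
    _ = ENNReal.ofReal C * ENNReal.ofReal (X * Y * Z) := by
        rw [ENNReal.ofReal_mul (mul_nonneg hX0 hY0), ENNReal.ofReal_mul hX0]; ring
    _ ≤ _ := mul_le_mul' le_rfl (ENNReal.ofReal_le_ofReal hreal)
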